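/- For all (x,y) ∈ ℝ² with x²+y² < 1/2: ∫₀¹ Ψ₀(x−s, y, 1−s) ds = 1/2 + (1/π)·arctan((2x−1)/√(1−2x²−2y²)). Moreover, for all (x,y) with |x|+|y| < 1 and x²+y² > 1/2, the integral ∫₀¹ Ψ₀(x−s, y, 1−s) ds equals 1 if x > 1/2 and equals 0 otherwise. -/

import Mathlib

noncomputable section

/-- `Ψ₀(x,y,t) = (1/π)(t²−2x²−2y²)^{−1/2}` on `2x²+2y² < t²`, and `0` otherwise. -/
noncomputable def Psi0 (x y t : ℝ) : ℝ :=
  if 2*x^2 + 2*y^2 < t^2 then (1/Real.pi) * (t^2 - 2*x^2 - 2*y^2) ^ (-(1:ℝ)/2) else 0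

/-- `Ψ_E(x,y) = ∫₀¹ Ψ₀(x−s, y, 1−s) ds`. -/
noncomputable def PsiE (x y : ℝ) : ℝ := ∫ s in (0:ℝ)..1, Psi0 (x - s) y (1 - s)

/-- `Ψ_N(x,y) = ∫₀¹ Ψ₀(x, y−s, 1−s) ds`. -/
noncomputable def PsiN (x y : ℝ) : ℝ := ∫ s in (0:ℝ)..1, Psi0 x (y - s) (1 - s)

/-- `Ψ_W(x,y) = ∫₀¹ Ψ₀(x+s, y, 1−s) ds`. -/
noncomputable def PsiW (x y : ℝ) : ℝ := ∫ s in (0:ℝ)..1, Psi0 (x + s) y (1 - s)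

/-- `Ψ_S(x,y) = ∫₀¹ Ψ₀(x, y+s, 1−s) ds`. -/
noncomputable def PsiS (x y : ℝ) : ℝ := ∫ s in (0:ℝ)..1, Psi0 x (y + s) (1 - s)

/-- `z(x,y) = Ψ_E + iΨ_N − Ψ_W − iΨ_S`. -/
noncomputable def zmap (x y : ℝ) : ℂ :=
  (PsiE x y : ℂ) + Complex.I * (PsiN x y : ℂ) - (PsiW x y : ℂ) - Complex.I * (PsiS x y : ℂ)

/-- `ϑ(x,y) = (1/√2)(Ψ_E − Ψ_N + Ψ_W − Ψ_S)`. -/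
noncomputable def thetamap (x y : ℝ) : ℝ :=
  (1 / Real.sqrt 2) * (PsiE x y - PsiN x y + PsiW x y - PsiS x y)

/-- The formula holds for arbitrary endpoints: outside `[-1, 1]` the integrand vanishes by
convention and `arcsin` is constant. -/
theorem integral_one_div_sqrt_one_sub_sq (a b : ℝ) :
    ∫ u in a..b, 1 / √(1 - u ^ 2) = Real.arcsin b - Real.arcsin a := by
  have hint := (Real.monotone_arcsin.monotoneOn (Set.uIcc a b)).intervalIntegrable_deriv
  rw [Real.deriv_arcsin] at hint
  refine MeasureTheory.integral_eq_of_hasDerivAt_off_countable _ _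
    (Set.toFinite {-1, 1}).countable Real.continuous_arcsin.continuousOn (fun u hu => ?_) hint
  have hu' : ¬ (u = -1 ∨ u = 1) := hu.2
  push Not at hu'
  exact Real.hasDerivAt_arcsin hu'.1 hu'.2

theorem Psi0_eq_one_div_sqrt (x y t : ℝ) :
    Psi0 x y t = (1 / Real.pi) * (1 / √(t ^ 2 - 2 * x ^ 2 - 2 * y ^ 2)) := by
  unfold Psi0
  split_ifs with h
  · rw [neg_div, Real.rpow_neg (by linarith), ← Real.sqrt_eq_rpow, one_div √_]
  · rw [Real.sqrt_eq_zero_of_nonpos (by linarith)]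
    simp

theorem integral_Psi0_eq_arcsin {x y r : ℝ} (hx : x ≤ 1) (hr : 0 < r)
    (h : r ^ 2 = (2 * x - 1) ^ 2 + (1 - 2 * x ^ 2 - 2 * y ^ 2)) :
    ∫ s in (0 : ℝ)..1, Psi0 (x - s) y (1 - s)
      = 1 / 2 + (1 / Real.pi) * Real.arcsin ((2 * x - 1) / r) := by
  have hcongr : ∀ s : ℝ, Psi0 (x - s) y (1 - s)
      = (1 / Real.pi * r⁻¹) * (1 / √(1 - (s / r - (2 * x - 1) / r) ^ 2)) := by
    intro s
    have hs : (1 - s) ^ 2 - 2 * (x - s) ^ 2 - 2 * y ^ 2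
        = r ^ 2 * (1 - (s / r - (2 * x - 1) / r) ^ 2) := by
      field_simp
      linear_combination -h
    rw [Psi0_eq_one_div_sqrt, hs, Real.sqrt_mul (sq_nonneg r), Real.sqrt_sq hr.le]
    simp only [one_div, mul_inv]
    ring
  have hone : 1 ≤ 1 / r - (2 * x - 1) / r := by
    rw [← sub_div, le_div_iff₀ hr]
    nlinarith [sq_nonneg (x - 1), sq_nonneg y]
  simp only [hcongr]
  rw [intervalIntegral.integral_const_mul,
    intervalIntegral.integral_comp_div_sub (fun u => 1 / √(1 - u ^ 2)) hr.ne',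
    integral_one_div_sqrt_one_sub_sq, Real.arcsin_of_one_le hone, zero_div, zero_sub,
    Real.arcsin_neg, smul_eq_mul]
  field_simp
  ring

/-- Explicit evaluation of `Ψ_E(x,y) = ∫₀¹ Ψ₀(x−s,y,1−s) ds`: inside the
disk `x²+y² < 1/2` it equals `1/2 + (1/π)·arctan((2x−1)/√(1−2x²−2y²))`, while in the frozen
part of the Aztec domain it equals `1` if `x > 1/2` and `0` otherwise. -/
theorem psiE_explicit_formula :
    (∀ x y : ℝ, x^2 + y^2 < 1/2 →
      (∫ s in (0:ℝ)..1, Psi0 (x - s) y (1 - s))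
        = 1/2 + (1/Real.pi) * Real.arctan ((2*x - 1) / Real.sqrt (1 - 2*x^2 - 2*y^2))) ∧
    (∀ x y : ℝ, |x| + |y| < 1 → 1/2 < x^2 + y^2 →
      ((1/2 < x → (∫ s in (0:ℝ)..1, Psi0 (x - s) y (1 - s)) = 1) ∧
       (¬ (1/2 < x) → (∫ s in (0:ℝ)..1, Psi0 (x - s) y (1 - s)) = 0))) := by
  refine ⟨fun x y h => ?_, fun x y h h' => ?_⟩
  · have hP : 0 < 1 - 2 * x ^ 2 - 2 * y ^ 2 := by linarith
    have hD : 0 < (2 * x - 1) ^ 2 + (1 - 2 * x ^ 2 - 2 * y ^ 2) := by positivity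
    have hr := Real.sqrt_pos.2 hD
    have hr2 := Real.sq_sqrt hD.le
    rw [integral_Psi0_eq_arcsin (by nlinarith) hr hr2]
    set r := √((2 * x - 1) ^ 2 + (1 - 2 * x ^ 2 - 2 * y ^ 2))
    have hlt : |2 * x - 1| < r := abs_lt_of_sq_lt_sq (by linarith) hr.le
    have hmem : (2 * x - 1) / r ∈ Set.Ioo (-1 : ℝ) 1 := by
      rw [Set.mem_Ioo, lt_div_iff₀ hr, div_lt_iff₀ hr, neg_one_mul, one_mul]
      exact abs_lt.1 hlt
    have hP' : 1 - 2 * x ^ 2 - 2 * y ^ 2 = r ^ 2 * (1 - ((2 * x - 1) / r) ^ 2) := by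
      field_simp
      linear_combination -hr2
    rw [Real.arcsin_eq_arctan hmem, hP', Real.sqrt_mul (sq_nonneg r), Real.sqrt_sq hr.le, div_div]
  · have hxy : |y| < 1 - x := by linarith [le_abs_self x]
    have hy : y ^ 2 < (1 - x) ^ 2 := sq_lt_sq' (abs_lt.1 hxy).1 (abs_lt.1 hxy).2
    have hD : 0 < (2 * x - 1) ^ 2 + (1 - 2 * x ^ 2 - 2 * y ^ 2) := by nlinarith
    have hr := Real.sqrt_pos.2 hD
    have hr2 := Real.sq_sqrt hD.le
    rw [integral_Psi0_eq_arcsin (by linarith [abs_nonneg y]) hr hr2]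
    set r := √((2 * x - 1) ^ 2 + (1 - 2 * x ^ 2 - 2 * y ^ 2))
    constructor
    · intro hx
      have hle : 1 ≤ (2 * x - 1) / r := by
        rw [le_div_iff₀ hr, one_mul]
        exact le_of_sq_le_sq (by linarith) (by linarith)
      rw [Real.arcsin_of_one_le hle]
      field_simp
      norm_num
    · intro hx
      have hle : (2 * x - 1) / r ≤ -1 := by
        rw [div_le_iff₀ hr]
        nlinarith
      rw [Real.arcsin_of_le_neg_one hle]
      field_simp
      norm_num

end
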